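/- There exists a universal constant C_σ > 0 such that the following holds. Under the four-block setup, the sub-block condition, and the noise condition at some level δ ∈ (0,1], define σ̂² := ω̂²/(NT) with ω̂² := (N/N1)·‖M_upper − U_up Σ_up V_upᵀ‖_F², and σ² := ω²/(NT). Then with probability at least 1 − C_σ·(N+T)^{-10}, |σ̂² − σ²| ≤ C_σ·σ²·√((N1+T)·r/(N1·T)). -/

import Mathlib

open Matrix MeasureTheory ProbabilityTheory
open scoped BigOperators ENNReal

noncomputable section

/-- Euclidean norm of a finite-dimensional real vector. -/
def vnorm {n : Type*} [Fintype n] (v : n → ℝ) : ℝ := Real.sqrt (∑ j, (v j) ^ 2)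

/-- Frobenius norm of a real matrix. -/
def frob {m n : Type*} [Fintype m] [Fintype n] (A : Matrix m n ℝ) : ℝ :=
  Real.sqrt (∑ i, ∑ j, (A i j) ^ 2)

/-- Spectral (ℓ₂ operator) norm of a real matrix. -/
def spec {m n : Type*} [Fintype m] [Fintype n] [DecidableEq n] (A : Matrix m n ℝ) : ℝ :=
  ‖LinearMap.toContinuousLinearMap (Matrix.toEuclideanLin A)‖

/-- `sval A k`: the k-th largest singular value of `A` (Courant–Fischer max–min). -/
def sval {m n : Type*} [Fintype m] [Fintype n] [DecidableEq n]
    (A : Matrix m n ℝ) (k : ℕ) : ℝ :=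
  ⨆ W : {W : Submodule ℝ (EuclideanSpace ℝ n) // Module.finrank ℝ ↥W = k},
    ⨅ x : {x : EuclideanSpace ℝ n // x ∈ W.1 ∧ ‖x‖ = 1},
      ‖Matrix.toEuclideanLin A x.1‖

/-- `(U, s, V)` is a rank-`r` truncated SVD of `A`. -/
structure IsTruncSVD {m n : ℕ} (r : ℕ) (A : Matrix (Fin m) (Fin n) ℝ)
    (U : Matrix (Fin m) (Fin r) ℝ) (s : Fin r → ℝ) (V : Matrix (Fin n) (Fin r) ℝ) : Prop where
  orthU : Uᵀ * U = 1
  orthV : Vᵀ * V = 1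
  nonneg : ∀ k, 0 ≤ s k
  anti : ∀ k l : Fin r, k ≤ l → s l ≤ s k
  right : A * V = U * Matrix.diagonal s
  left : Aᵀ * U = V * Matrix.diagonal s
  top : ∀ k : Fin r, s k = sval A (k.1 + 1)

/-- `H` is the orthogonal polar factor (the "matrix sign") of `A`. -/
def IsPolarSign {r : ℕ} (A H : Matrix (Fin r) (Fin r) ℝ) : Prop :=
  Hᵀ * H = 1 ∧ H * Hᵀ = 1 ∧ (Hᵀ * A).PosSemidef

/-- The submatrix of the top `N1` rows. -/
def topRows {N r N1 : ℕ} (h : N1 ≤ N) (A : Matrix (Fin N) (Fin r) ℝ) :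
    Matrix (Fin N1) (Fin r) ℝ :=
  A.submatrix (Fin.castLE h) id



/-! ### Deterministic part -/

lemma frob_sq {m n : ℕ} (A : Matrix (Fin m) (Fin n) ℝ) :
    frob A ^ 2 = ∑ i, ∑ j, (A i j) ^ 2 := by
  unfold frob
  rw [Real.sq_sqrt]
  positivity

lemma frob_sq_basis {m n : ℕ} (A : Matrix (Fin m) (Fin n) ℝ)
    (b : OrthonormalBasis (Fin n) ℝ (EuclideanSpace ℝ (Fin n))) :
    frob A ^ 2 = ∑ j, ‖Matrix.toEuclideanLin A (b j)‖ ^ 2 := by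
  rw [frob_sq]
  have h1 : ∀ i, ∑ j, (A i j) ^ 2 = ∑ j, (∑ k, A i k * b j k) ^ 2 := by
    intro i
    have := b.sum_sq_norm_inner_right (WithLp.toLp 2 (A i))
    rw [EuclideanSpace.norm_sq_eq] at this
    simp only [Real.norm_eq_abs, sq_abs, PiLp.inner_apply, RCLike.inner_apply, conj_trivial] at this
    rw [← this]
  simp_rw [h1]
  rw [Finset.sum_comm]
  refine Finset.sum_congr rfl fun j _ => ?_
  rw [EuclideanSpace.norm_sq_eq]
  refine Finset.sum_congr rfl fun i _ => ?_
  rw [Real.norm_eq_abs, sq_abs]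
  rfl

lemma frob_diff {m n q : ℕ} (R E : Matrix (Fin m) (Fin n) ℝ) (e : ℝ)
    (hrank : (R - E).rank ≤ q)
    (hR : ∀ x, ‖Matrix.toEuclideanLin R x‖ ≤ e * ‖x‖)
    (hE : ∀ x, ‖Matrix.toEuclideanLin E x‖ ≤ e * ‖x‖) :
    |frob R ^ 2 - frob E ^ 2| ≤ q * e ^ 2 := by
  set D := R - E with hD
  have hH : (Dᵀ * D).IsHermitian := by
    rw [Matrix.IsHermitian, Matrix.conjTranspose_eq_transpose_of_trivial, Matrix.transpose_mul,
      Matrix.transpose_transpose]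
  set b := hH.eigenvectorBasis with hb
  rw [frob_sq_basis R b, frob_sq_basis E b, ← Finset.sum_sub_distrib]
  have hz : ∀ j, hH.eigenvalues j = 0 →
      Matrix.toEuclideanLin R (b j) = Matrix.toEuclideanLin E (b j) := by
    intro j hj
    have h1 := hH.mulVec_eigenvectorBasis j
    rw [hj, zero_smul] at h1
    have h2 : D *ᵥ (b j).ofLp = 0 := by
      rw [← Matrix.mulVec_mulVec] at h1
      have h3 : (D *ᵥ (b j).ofLp) ⬝ᵥ (D *ᵥ (b j).ofLp) = 0 := by
        have : (b j).ofLp ⬝ᵥ (Dᵀ *ᵥ (D *ᵥ (b j).ofLp)) = 0 := by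
          rw [h1]; simp
        rw [Matrix.dotProduct_mulVec, Matrix.vecMul_transpose] at this
        exact this
      exact dotProduct_self_eq_zero.mp h3
    have h4 : Matrix.toEuclideanLin D (b j) = 0 := by
      ext i
      exact congrFun h2 i
    rw [hD, map_sub, LinearMap.sub_apply, sub_eq_zero] at h4
    exact h4
  have hterm : ∀ j, |‖Matrix.toEuclideanLin R (b j)‖ ^ 2 - ‖Matrix.toEuclideanLin E (b j)‖ ^ 2|
      ≤ if hH.eigenvalues j ≠ 0 then e ^ 2 else 0 := by
    intro j
    split_ifs with h
    · have h1 := hR (b j)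
      have h2 := hE (b j)
      rw [b.norm_eq_one, mul_one] at h1 h2
      have h3 := pow_le_pow_left₀ (norm_nonneg _) h1 2
      have h4 := pow_le_pow_left₀ (norm_nonneg _) h2 2
      rw [abs_le]
      constructor <;> nlinarith [sq_nonneg ‖Matrix.toEuclideanLin R (b j)‖,
        sq_nonneg ‖Matrix.toEuclideanLin E (b j)‖]
    · push Not at h
      rw [hz j h]; simp
  calc _ ≤ ∑ j, |‖Matrix.toEuclideanLin R (b j)‖ ^ 2 - ‖Matrix.toEuclideanLin E (b j)‖ ^ 2| :=
        Finset.abs_sum_le_sum_abs _ _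
    _ ≤ ∑ j, if hH.eigenvalues j ≠ 0 then e ^ 2 else 0 := Finset.sum_le_sum fun j _ => hterm j
    _ = ((Dᵀ * D).rank : ℝ) * e ^ 2 := by
        rw [hH.rank_eq_card_non_zero_eigs, Fintype.card_subtype, ← Finset.sum_filter]
        simp
    _ ≤ q * e ^ 2 := by
        rw [Matrix.rank_transpose_mul_self]
        gcongr

lemma family_lower {n m k : ℕ} (L : EuclideanSpace ℝ (Fin n) →ₗ[ℝ] EuclideanSpace ℝ (Fin m))
    (q : Fin k → EuclideanSpace ℝ (Fin n)) (hq : Orthonormal ℝ q) (t : ℝ) (ht : 0 ≤ t)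
    (horth : ∀ i j, i ≠ j → inner ℝ (L (q i)) (L (q j)) = 0)
    (hnorm : ∀ i, t ≤ ‖L (q i)‖) :
    ∃ W : Submodule ℝ (EuclideanSpace ℝ (Fin n)), Module.finrank ℝ W = k ∧
      ∀ y ∈ W, t * ‖y‖ ≤ ‖L y‖ := by
  refine ⟨Submodule.span ℝ (Set.range q), ?_, ?_⟩
  · rw [finrank_span_eq_card hq.linearIndependent, Fintype.card_fin]
  · intro y hy
    obtain ⟨c, rfl⟩ := (Submodule.mem_span_range_iff_exists_fun ℝ).mp hy
    have h1 : ‖∑ i, c i • q i‖ ^ 2 = ∑ i, c i ^ 2 := by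
      rw [← real_inner_self_eq_norm_sq, hq.inner_sum]
      simp [sq]
    have h2 : ‖L (∑ i, c i • q i)‖ ^ 2 = ∑ i, c i ^ 2 * ‖L (q i)‖ ^ 2 := by
      rw [← real_inner_self_eq_norm_sq, map_sum]
      simp only [map_smul, sum_inner, inner_sum, inner_smul_left, inner_smul_right]
      refine Finset.sum_congr rfl fun i _ => ?_
      rw [Finset.sum_eq_single i]
      · rw [real_inner_self_eq_norm_sq]; simp; ring
      · intro j _ hj
        rw [horth _ _ hj]; simp
      · simp
    refine (pow_le_pow_iff_left₀ (by positivity) (norm_nonneg _) two_ne_zero).mp ?_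
    rw [mul_pow, h1, h2, Finset.mul_sum]
    refine Finset.sum_le_sum fun i _ => ?_
    rw [mul_comm]
    have := pow_le_pow_left₀ ht (hnorm i) 2
    gcongr

lemma le_sval {n m k : ℕ} (A : Matrix (Fin m) (Fin n) ℝ) (hk : 0 < k)
    (W : Submodule ℝ (EuclideanSpace ℝ (Fin n))) (hW : Module.finrank ℝ W = k) (t : ℝ)
    (h : ∀ y ∈ W, t * ‖y‖ ≤ ‖Matrix.toEuclideanLin A y‖) : t ≤ sval A k := by
  have hne : ∀ W : Submodule ℝ (EuclideanSpace ℝ (Fin n)), Module.finrank ℝ W = k →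
      ∃ x : EuclideanSpace ℝ (Fin n), x ∈ W ∧ ‖x‖ = 1 := by
    intro W hW
    have : Nontrivial W := Module.nontrivial_of_finrank_pos (R := ℝ) (by omega)
    obtain ⟨x, hx⟩ := exists_norm_eq W (zero_le_one (α := ℝ))
    exact ⟨x, x.2, hx⟩
  set B := LinearMap.toContinuousLinearMap (Matrix.toEuclideanLin A) with hB
  have hbdd : BddAbove (Set.range fun W : {W : Submodule ℝ (EuclideanSpace ℝ (Fin n)) //
      Module.finrank ℝ ↥W = k} => ⨅ x : {x : EuclideanSpace ℝ (Fin n) // x ∈ W.1 ∧ ‖x‖ = 1},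
      ‖Matrix.toEuclideanLin A x.1‖) := by
    refine ⟨‖B‖, ?_⟩
    rintro _ ⟨W, rfl⟩
    obtain ⟨x, hx, hx1⟩ := hne W.1 W.2
    refine (ciInf_le ⟨0, ?_⟩ (⟨x, hx, hx1⟩ : {x : EuclideanSpace ℝ (Fin n) //
      x ∈ W.1 ∧ ‖x‖ = 1})).trans ?_
    · rintro _ ⟨y, rfl⟩
      exact norm_nonneg _
    · have := B.le_opNorm x
      rw [hx1, mul_one] at this
      exact this
  refine le_trans ?_ (le_ciSup hbdd ⟨W, hW⟩)
  obtain ⟨x, hx, hx1⟩ := hne W hW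
  have : Nonempty {x : EuclideanSpace ℝ (Fin n) // x ∈ W ∧ ‖x‖ = 1} := ⟨⟨x, hx, hx1⟩⟩
  refine le_ciInf fun y => ?_
  have := h y.1 y.2.1
  rw [y.2.2, mul_one] at this
  exact this

/-- column of a matrix as a Euclidean vector -/
def ecol {n r : ℕ} (V : Matrix (Fin n) (Fin r) ℝ) (k : Fin r) : EuclideanSpace ℝ (Fin n) :=
  WithLp.toLp 2 (fun i => V i k)

lemma inner_ecol {n r : ℕ} (V W : Matrix (Fin n) (Fin r) ℝ) (k l : Fin r) :
    inner ℝ (ecol V k) (ecol W l) = (Vᵀ * W) k l := by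
  simp [ecol, PiLp.inner_apply, Matrix.mul_apply, mul_comm]

lemma orthonormal_ecol {n r : ℕ} (V : Matrix (Fin n) (Fin r) ℝ) (h : Vᵀ * V = 1) :
    Orthonormal ℝ (ecol V) := by
  rw [orthonormal_iff_ite]
  intro i j
  rw [inner_ecol, h, Matrix.one_apply]

lemma inner_adj {n m : ℕ} (A : Matrix (Fin m) (Fin n) ℝ) (x : EuclideanSpace ℝ (Fin n))
    (y : EuclideanSpace ℝ (Fin m)) :
    inner ℝ (Matrix.toEuclideanLin A x) y = inner ℝ x (Matrix.toEuclideanLin Aᵀ y) := by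
  have h1 : inner ℝ (Matrix.toEuclideanLin A x) y = y.ofLp ⬝ᵥ (A *ᵥ x.ofLp) := by
    simp [PiLp.inner_apply, dotProduct]
  have h2 : inner ℝ x (Matrix.toEuclideanLin Aᵀ y) = (Aᵀ *ᵥ y.ofLp) ⬝ᵥ x.ofLp := by
    simp [PiLp.inner_apply, dotProduct]
  rw [h1, h2, Matrix.dotProduct_mulVec, Matrix.mulVec_transpose]

lemma lin_ecol {m n r : ℕ} (A : Matrix (Fin m) (Fin n) ℝ) (V : Matrix (Fin n) (Fin r) ℝ)
    (U : Matrix (Fin m) (Fin r) ℝ) (s : Fin r → ℝ) (h : A * V = U * Matrix.diagonal s)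
    (k : Fin r) : Matrix.toEuclideanLin A (ecol V k) = s k • ecol U k := by
  ext i
  have h1 := congrFun (congrFun h i) k
  rw [Matrix.mul_diagonal] at h1
  calc _ = (A * V) i k := rfl
    _ = _ := by rw [h1]; simp [ecol, mul_comm]

lemma svd_family {m n r : ℕ} {Y : Matrix (Fin m) (Fin n) ℝ} {U : Matrix (Fin m) (Fin r) ℝ}
    {s : Fin r → ℝ} {V : Matrix (Fin n) (Fin r) ℝ} (hS : IsTruncSVD r Y U s V)
    (x : EuclideanSpace ℝ (Fin n)) (hx1 : ‖x‖ = 1) (hxV : ∀ k, inner ℝ x (ecol V k) = 0)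
    (j : ℕ) (hj : j ≤ r) (hs : ∀ k : Fin r, k.1 < j → ‖Matrix.toEuclideanLin Y x‖ ≤ s k) :
    ∃ W : Submodule ℝ (EuclideanSpace ℝ (Fin n)), Module.finrank ℝ W = j + 1 ∧
      ∀ y ∈ W, ‖Matrix.toEuclideanLin Y x‖ * ‖y‖ ≤ ‖Matrix.toEuclideanLin Y y‖ := by
  have hV := orthonormal_iff_ite.mp (orthonormal_ecol V hS.orthV)
  have hU := orthonormal_iff_ite.mp (orthonormal_ecol U hS.orthU)
  have hxV' : ∀ k, inner ℝ (ecol V k) x = 0 := fun k => by rw [real_inner_comm]; exact hxV k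
  have hxU : ∀ k, inner ℝ (Matrix.toEuclideanLin Y x) (ecol U k) = 0 := by
    intro k
    rw [inner_adj, lin_ecol Yᵀ U V s hS.left, inner_smul_right, hxV, mul_zero]
  have hxU' : ∀ k, inner ℝ (ecol U k) (Matrix.toEuclideanLin Y x) = 0 :=
    fun k => by rw [real_inner_comm]; exact hxU k
  let q : Fin (j + 1) → EuclideanSpace ℝ (Fin n) := fun i =>
    if h : i.1 < j then ecol V ⟨i.1, by omega⟩ else x
  refine family_lower (Matrix.toEuclideanLin Y) q ?_ _ (norm_nonneg _) ?_ ?_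
  · rw [orthonormal_iff_ite]
    intro a b
    by_cases ha : a.1 < j <;> by_cases hb : b.1 < j
    · simp [q, ha, hb, hV, Fin.ext_iff]
    · have : a ≠ b := by rintro rfl; exact hb ha
      simp [q, ha, hb, hxV', this]
    · have : a ≠ b := by rintro rfl; exact ha hb
      simp [q, ha, hb, hxV, this]
    · have : a = b := by ext; omega
      simp [q, hb, this, hx1]
  · intro a b hab
    have hab' : a.1 ≠ b.1 := fun h => hab (Fin.ext h)
    by_cases ha : a.1 < j <;> by_cases hb : b.1 < j
    · simp only [q, ha, hb, dif_pos]
      rw [lin_ecol Y V U s hS.right, lin_ecol Y V U s hS.right, inner_smul_left, inner_smul_right,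
        hU, if_neg (by simpa [Fin.ext_iff] using hab')]
      simp
    · simp only [q, ha, hb, dif_pos]
      rw [lin_ecol Y V U s hS.right, dif_neg (by simp), inner_smul_left, hxU', mul_zero]
    · simp only [q, ha, hb, dif_pos]
      rw [lin_ecol Y V U s hS.right, dif_neg (by simp), inner_smul_right, hxU, mul_zero]
    · omega
  · intro a
    by_cases ha : a.1 < j
    · simp only [q, ha, dif_pos]
      rw [lin_ecol Y V U s hS.right, norm_smul, (orthonormal_ecol U hS.orthU).1, mul_one,
        Real.norm_eq_abs]
      exact (hs _ ha).trans (le_abs_self _)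
    · simp [q, ha]

lemma weyl_perp {m n r : ℕ} {Y A E : Matrix (Fin m) (Fin n) ℝ} {U : Matrix (Fin m) (Fin r) ℝ}
    {s : Fin r → ℝ} {V : Matrix (Fin n) (Fin r) ℝ} (hS : IsTruncSVD r Y U s V)
    (hY : Y = A + E) (B : Matrix (Fin m) (Fin r) ℝ) (C : Matrix (Fin r) (Fin n) ℝ)
    (hA : A = B * C) (e : ℝ) (hE : ∀ x, ‖Matrix.toEuclideanLin E x‖ ≤ e * ‖x‖)
    (x : EuclideanSpace ℝ (Fin n)) (hx1 : ‖x‖ = 1) (hxV : ∀ k, inner ℝ x (ecol V k) = 0) :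
    ‖Matrix.toEuclideanLin Y x‖ ≤ e := by
  have hs : ∀ j : ℕ, ∀ k : Fin r, k.1 = j → ‖Matrix.toEuclideanLin Y x‖ ≤ s k := by
    intro j
    induction j using Nat.strong_induction_on with
    | _ j ih =>
      intro k hk
      obtain ⟨W, hW, hWy⟩ := svd_family hS x hx1 hxV j (by omega)
        (fun l hl => ih l.1 hl l rfl)
      rw [hS.top k, hk]
      exact le_sval Y (by omega) W hW _ hWy
  obtain ⟨W, hW, hWy⟩ := svd_family hS x hx1 hxV r le_rfl (fun l _ => hs l.1 l rfl)
  have hker := LinearMap.ker_ne_bot_of_finrank_lt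
    (f := (Matrix.toEuclideanLin C).comp W.subtype) (by
      rw [hW, finrank_euclideanSpace, Fintype.card_fin]; omega)
  obtain ⟨y, hy, hy0⟩ := Submodule.exists_mem_ne_zero_of_ne_bot hker
  have hy' : Matrix.toEuclideanLin C y.1 = 0 := hy
  have hCy : C *ᵥ y.1.ofLp = 0 := by
    funext i
    exact congrArg (fun z : EuclideanSpace ℝ (Fin r) => z i) hy'
  have hAy : Matrix.toEuclideanLin A y.1 = 0 := by
    ext i
    have : (A *ᵥ y.1.ofLp) i = 0 := by
      rw [hA, ← Matrix.mulVec_mulVec, hCy]; simp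
    exact this
  have h1 := hWy y.1 y.2
  have h2 : Matrix.toEuclideanLin Y y.1 = Matrix.toEuclideanLin E y.1 := by
    rw [hY, map_add, LinearMap.add_apply, hAy, zero_add]
  rw [h2] at h1
  have h3 : 0 < ‖y.1‖ := by
    rw [norm_pos_iff]
    intro h
    exact hy0 (Subtype.ext h)
  exact le_of_mul_le_mul_right (h1.trans (hE _)) h3

lemma resid_op {m n r : ℕ} {Y A E : Matrix (Fin m) (Fin n) ℝ} {U : Matrix (Fin m) (Fin r) ℝ}
    {s : Fin r → ℝ} {V : Matrix (Fin n) (Fin r) ℝ} (hS : IsTruncSVD r Y U s V)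
    (hY : Y = A + E) (B : Matrix (Fin m) (Fin r) ℝ) (C : Matrix (Fin r) (Fin n) ℝ)
    (hA : A = B * C) (e : ℝ) (he : 0 ≤ e) (hE : ∀ x, ‖Matrix.toEuclideanLin E x‖ ≤ e * ‖x‖)
    (x : EuclideanSpace ℝ (Fin n)) :
    ‖Matrix.toEuclideanLin (Y - U * Matrix.diagonal s * Vᵀ) x‖ ≤ e * ‖x‖ := by
  have hON := orthonormal_ecol V hS.orthV
  set p : EuclideanSpace ℝ (Fin n) := ∑ k, inner ℝ (ecol V k) x • ecol V k with hp
  have hpV : ∀ k, inner ℝ (x - p) (ecol V k) = 0 := by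
    intro k
    rw [inner_sub_left, hp, real_inner_comm, real_inner_comm (ecol V k) (∑ k, _),
      hON.inner_right_fintype, sub_self]
  have hperp : inner ℝ (x - p) p = 0 := by
    rw [hp, inner_sum]
    refine Finset.sum_eq_zero fun k _ => ?_
    rw [inner_smul_right, ← hp, hpV, mul_zero]
  have hnorm : ‖x - p‖ ≤ ‖x‖ := by
    have : ‖x‖ ^ 2 = ‖x - p‖ ^ 2 + ‖p‖ ^ 2 := by
      have h := norm_add_sq_real (x - p) p
      rw [hperp, sub_add_cancel] at h
      linarith
    refine (pow_le_pow_iff_left₀ (norm_nonneg _) (norm_nonneg _) two_ne_zero).mp ?_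
    nlinarith [sq_nonneg ‖p‖]
  have hR : Matrix.toEuclideanLin (Y - U * Matrix.diagonal s * Vᵀ) x
      = Matrix.toEuclideanLin Y (x - p) := by
    have hpe : p = Matrix.toEuclideanLin (V * Vᵀ) x := by
      ext i
      have : (V *ᵥ (Vᵀ *ᵥ x.ofLp)) i = p i := by
        simp [hp, ecol, Matrix.mulVec, dotProduct, PiLp.inner_apply, mul_comm]
      rw [Matrix.mulVec_mulVec] at this
      exact this.symm
    rw [map_sub, LinearMap.sub_apply, map_sub, hpe]
    congr 1
    ext i
    have : ((U * Matrix.diagonal s * Vᵀ) *ᵥ x.ofLp) i = (Y *ᵥ ((V * Vᵀ) *ᵥ x.ofLp)) i := by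
      rw [Matrix.mulVec_mulVec, ← Matrix.mul_assoc, hS.right]
    exact this
  rw [hR]
  refine le_trans ?_ (mul_le_mul_of_nonneg_left hnorm he)
  by_cases h0 : x - p = 0
  · rw [h0]; simp
  · have hn : 0 < ‖x - p‖ := norm_pos_iff.mpr h0
    have h := weyl_perp hS hY B C hA e hE (‖x - p‖⁻¹ • (x - p))
      (by rw [norm_smul, norm_inv, norm_norm, inv_mul_cancel₀ hn.ne'])
      (fun k => by rw [inner_smul_left, hpV, mul_zero])
    rw [map_smul, norm_smul, norm_inv, norm_norm, inv_mul_le_iff₀ hn] at h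
    linarith

lemma frob_resid {m n r : ℕ} {Y A E : Matrix (Fin m) (Fin n) ℝ} {U : Matrix (Fin m) (Fin r) ℝ}
    {s : Fin r → ℝ} {V : Matrix (Fin n) (Fin r) ℝ} (hS : IsTruncSVD r Y U s V)
    (hY : Y = A + E) (B : Matrix (Fin m) (Fin r) ℝ) (C : Matrix (Fin r) (Fin n) ℝ)
    (hA : A = B * C) (e : ℝ) (he : 0 ≤ e) (hE : ∀ x, ‖Matrix.toEuclideanLin E x‖ ≤ e * ‖x‖) :
    |frob (Y - U * Matrix.diagonal s * Vᵀ) ^ 2 - frob E ^ 2| ≤ 2 * r * e ^ 2 := by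
  have := frob_diff (q := r + r) (Y - U * Matrix.diagonal s * Vᵀ) E e ?_
    (resid_op hS hY B C hA e he hE) hE
  · push_cast at this
    linarith
  · have : Y - U * Matrix.diagonal s * Vᵀ - E
        = Matrix.fromCols B (-(U * Matrix.diagonal s)) * Matrix.fromRows C Vᵀ := by
      rw [Matrix.fromCols_mul_fromRows, hY, hA, Matrix.neg_mul]; abel
    rw [this]
    refine (Matrix.rank_mul_le_left _ _).trans ((Matrix.rank_le_card_width _).trans ?_)
    simp

lemma orth_le {n r : ℕ} (V : Matrix (Fin n) (Fin r) ℝ) (h : Vᵀ * V = 1) : r ≤ n := by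
  have := (orthonormal_ecol V h).linearIndependent.fintype_card_le_finrank
  simpa using this

/-! ### Nets -/

lemma exists_net (n : ℕ) : ∃ s : Finset (EuclideanSpace ℝ (Fin n)),
    (∀ c ∈ s, ‖c‖ ≤ 2) ∧ s.card ≤ 5 ^ n ∧ ∀ x : EuclideanSpace ℝ (Fin n), ‖x‖ ≤ 2 →
      ∃ c ∈ s, ‖x - c‖ ≤ 1 := by
  classical
  let p : Finset (EuclideanSpace ℝ (Fin n)) → Prop := fun s =>
    (∀ c ∈ s, ‖c‖ ≤ 2) ∧ ∀ c ∈ s, ∀ d ∈ s, c ≠ d → 1 ≤ ‖c - d‖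
  have hcard : ∀ s, p s → s.card ≤ 5 ^ n := by
    intro s hs
    have := Besicovitch.card_le_of_separated s hs.1 hs.2
    simpa using this
  let Q : ℕ → Prop := fun k => ∃ s, p s ∧ s.card = k
  have hQ0 : Q 0 := ⟨∅, ⟨by simp, by simp⟩, by simp⟩
  obtain ⟨s, hs, hsc⟩ : Q (Nat.findGreatest Q (5 ^ n)) :=
    Nat.findGreatest_spec (P := Q) (Nat.zero_le _) hQ0
  refine ⟨s, hs.1, hcard s hs, ?_⟩
  intro x hx
  by_contra! hcon
  have hxs : x ∉ s := fun h => by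
    have := hcon x h
    simp at this
    linarith
  have hp : p (insert x s) := by
    refine ⟨?_, ?_⟩
    · intro c hc
      rcases Finset.mem_insert.mp hc with rfl | hc
      · exact hx
      · exact hs.1 c hc
    · intro c hc d hd hne
      rcases Finset.mem_insert.mp hc with rfl | hc' <;>
        rcases Finset.mem_insert.mp hd with rfl | hd'
      · exact absurd rfl hne
      · exact (hcon d hd').le
      · rw [norm_sub_rev]; exact (hcon c hc').le
      · exact hs.2 c hc' d hd' hne
  have h1 : Q (s.card + 1) := ⟨insert x s, hp, Finset.card_insert_of_notMem hxs⟩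
  have h2 : s.card + 1 ≤ 5 ^ n := by
    rw [← Finset.card_insert_of_notMem hxs]; exact hcard _ hp
  have h3 := Nat.le_findGreatest (P := Q) h2 h1
  omega

lemma net_vec {n : ℕ} (s : Finset (EuclideanSpace ℝ (Fin n)))
    (hs : ∀ x : EuclideanSpace ℝ (Fin n), ‖x‖ ≤ 2 → ∃ c ∈ s, ‖x - c‖ ≤ 1)
    (v : EuclideanSpace ℝ (Fin n)) (t : ℝ) (ht : 0 ≤ t) (h : ∀ c ∈ s, inner ℝ c v ≤ t) :
    ‖v‖ ≤ t := by
  by_cases hv : v = 0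
  · simpa [hv] using ht
  have hn : 0 < ‖v‖ := norm_pos_iff.mpr hv
  obtain ⟨c, hc, hxc⟩ := hs ((2 * ‖v‖⁻¹) • v) (by
    rw [norm_smul, Real.norm_of_nonneg (by positivity), mul_assoc, inv_mul_cancel₀ hn.ne']
    norm_num)
  have h1 : inner ℝ ((2 * ‖v‖⁻¹) • v) v = 2 * ‖v‖ := by
    rw [real_inner_smul_left, real_inner_self_eq_norm_sq]
    field_simp
  have h2 : inner ℝ ((2 * ‖v‖⁻¹) • v - c) v ≤ ‖v‖ := by
    refine (real_inner_le_norm _ _).trans ?_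
    nlinarith
  rw [inner_sub_left, h1] at h2
  have := h c hc
  linarith

lemma net_op {m n : ℕ} (A : Matrix (Fin m) (Fin n) ℝ)
    (s : Finset (EuclideanSpace ℝ (Fin m))) (s' : Finset (EuclideanSpace ℝ (Fin n)))
    (hs : ∀ x : EuclideanSpace ℝ (Fin m), ‖x‖ ≤ 2 → ∃ c ∈ s, ‖x - c‖ ≤ 1)
    (hs' : ∀ x : EuclideanSpace ℝ (Fin n), ‖x‖ ≤ 2 → ∃ c ∈ s', ‖x - c‖ ≤ 1)
    (t : ℝ) (ht : 0 ≤ t)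
    (h : ∀ c ∈ s, ∀ d ∈ s', inner ℝ c (Matrix.toEuclideanLin A d) ≤ t) :
    ∀ x, ‖Matrix.toEuclideanLin A x‖ ≤ t * ‖x‖ := by
  set B := LinearMap.toContinuousLinearMap (Matrix.toEuclideanLin A) with hB
  have hBA : ∀ x, Matrix.toEuclideanLin A x = B x := fun _ => rfl
  have h1 : ∀ d ∈ s', ‖B d‖ ≤ t := fun d hd => net_vec s hs _ t ht fun c hc => h c hc d hd
  have h2 : ‖B‖ ≤ (t + ‖B‖) / 2 := by
    refine B.opNorm_le_bound (by positivity) fun x => ?_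
    by_cases hx : x = 0
    · simp [hx]
    have hn : 0 < ‖x‖ := norm_pos_iff.mpr hx
    obtain ⟨d, hd, hxd⟩ := hs' ((2 * ‖x‖⁻¹) • x) (by
      rw [norm_smul, Real.norm_of_nonneg (by positivity), mul_assoc, inv_mul_cancel₀ hn.ne']
      norm_num)
    have h3 : ‖B ((2 * ‖x‖⁻¹) • x)‖ ≤ t + ‖B‖ := by
      have : B ((2 * ‖x‖⁻¹) • x) = B d + B ((2 * ‖x‖⁻¹) • x - d) := by
        rw [map_sub]; abel
      rw [this]
      refine (norm_add_le _ _).trans (add_le_add (h1 d hd) ?_)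
      refine (B.le_opNorm _).trans ?_
      nlinarith [norm_nonneg B]
    rw [map_smul, norm_smul, Real.norm_of_nonneg (by positivity)] at h3
    have h4 : 2 * ‖x‖⁻¹ * ‖B x‖ * ‖x‖ ≤ (t + ‖B‖) * ‖x‖ :=
      mul_le_mul_of_nonneg_right h3 hn.le
    have h5 : 2 * ‖x‖⁻¹ * ‖B x‖ * ‖x‖ = 2 * ‖B x‖ := by field_simp
    linarith
  intro x
  rw [hBA]
  refine (B.le_opNorm x).trans ?_
  gcongr
  linarith

/-! ### Probability -/

lemma chernoff {Ω ι : Type*} [MeasurableSpace Ω] [Fintype ι] (P : Measure Ω)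
    [IsProbabilityMeasure P] (X : ι → Ω → ℝ) (hm : ∀ i, Measurable (X i)) (hi : iIndepFun X P)
    (l : ℝ) (hl : 0 ≤ l) (c : ι → ℝ)
    (hexpI : ∀ i, Integrable (fun ω => Real.exp (l * X i ω)) P)
    (hc : ∀ i, mgf (X i) P l ≤ Real.exp (c i)) (t : ℝ) :
    P {ω | t ≤ ∑ i, X i ω} ≤ ENNReal.ofReal (Real.exp (∑ i, c i - l * t)) := by
  have h1 := measure_ge_le_exp_mul_mgf (μ := P) (X := ∑ i, X i) t hl
    (hi.integrable_exp_mul_sum hm fun i _ => hexpI i)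
  rw [hi.mgf_sum hm] at h1
  have h2 : ∏ i, mgf (X i) P l ≤ Real.exp (∑ i, c i) := by
    rw [Real.exp_sum]
    exact Finset.prod_le_prod (fun i _ => mgf_nonneg) fun i _ => hc i
  have h3 : P.real {ω | t ≤ (∑ i, X i) ω} ≤ Real.exp (∑ i, c i - l * t) := by
    refine h1.trans ((mul_le_mul_of_nonneg_left h2 (Real.exp_pos _).le).trans ?_)
    rw [← Real.exp_add]
    apply le_of_eq; congr 1; ring
  simp only [Finset.sum_apply] at h3
  rw [← ENNReal.ofReal_toReal (measure_ne_top P {ω | t ≤ ∑ i, X i ω})]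
  exact ENNReal.ofReal_le_ofReal h3

lemma gauss_sq_integrable (v : NNReal) (hv : v ≠ 0) (l : ℝ) (hl : |l| ≤ 1 / 4) :
    Integrable (fun x : ℝ => Real.exp (l * (x ^ 2 / v - 1))) (gaussianReal 0 v) ∧
    ∫ x, Real.exp (l * (x ^ 2 / v - 1)) ∂(gaussianReal 0 v) ≤ Real.exp (4 * l ^ 2) := by
  have hv0 : (0 : ℝ) < v := by positivity
  obtain ⟨hl1, hl2⟩ := abs_le.mp hl
  have hb : 0 < (1 - 2 * l) / (2 * v) := by
    apply div_pos <;> linarith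
  have hfun : ∀ x : ℝ, gaussianPDFReal 0 v x • Real.exp (l * (x ^ 2 / v - 1))
      = (√(2 * Real.pi * v))⁻¹ * Real.exp (-l) *
        Real.exp (-((1 - 2 * l) / (2 * v)) * x ^ 2) := by
    intro x
    rw [gaussianPDFReal, smul_eq_mul, mul_assoc, mul_assoc _ (Real.exp _) (Real.exp _), ← Real.exp_add,
      ← Real.exp_add]
    congr 2
    field_simp
    ring
  constructor
  · rw [gaussianReal_of_var_ne_zero _ hv, integrable_withDensity_iff_integrable_smul₀']
    · have : (fun x : ℝ => (gaussianPDF 0 v x).toReal • Real.exp (l * (x ^ 2 / v - 1)))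
        = fun x => (√(2 * Real.pi * v))⁻¹ * Real.exp (-l) *
          Real.exp (-((1 - 2 * l) / (2 * v)) * x ^ 2) := by
        funext x
        rw [← hfun, toReal_gaussianPDF]
      rw [this]
      exact (integrable_exp_neg_mul_sq hb).const_mul _
    · exact (measurable_gaussianPDF 0 v).aemeasurable
    · exact Filter.Eventually.of_forall fun x => gaussianPDF_lt_top
  · rw [integral_gaussianReal_eq_integral_smul hv]
    simp_rw [hfun]
    rw [integral_const_mul, integral_gaussian]
    have h1 : √(Real.pi / ((1 - 2 * l) / (2 * v))) = √(2 * Real.pi * v) * (√(1 - 2 * l))⁻¹ := by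
      rw [← Real.sqrt_inv, ← Real.sqrt_mul (by positivity)]
      congr 1
      field_simp
    rw [h1]
    have h2 : √(2 * Real.pi * v) ≠ 0 := by positivity
    have h3 : (√(2 * Real.pi * v))⁻¹ * Real.exp (-l) * (√(2 * Real.pi * v) * (√(1 - 2 * l))⁻¹)
      = Real.exp (-l) * (√(1 - 2 * l))⁻¹ := by field_simp
    rw [h3]
    have h4 : (√(1 - 2 * l))⁻¹ = Real.exp (-(Real.log (1 - 2 * l) / 2)) := by
      rw [Real.exp_neg, ← Real.log_sqrt (by linarith), Real.exp_log (Real.sqrt_pos.mpr (by linarith))]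
    rw [h4, ← Real.exp_add]
    apply Real.exp_le_exp.mpr
    have habs : |2 * l| ≤ 1 / 2 := by rw [abs_mul, abs_two]; linarith
    have h5 := Real.abs_log_sub_add_sum_range_le (x := 2 * l) (by linarith) 1
    simp only [Finset.range_one, Finset.sum_singleton] at h5
    norm_num at h5
    have h6 : (2 * |l|) ^ 2 / (1 - 2 * |l|) ≤ 8 * l ^ 2 := by
      rw [div_le_iff₀ (by linarith)]
      rw [mul_pow, sq_abs]
      nlinarith [sq_nonneg l]
    have h7 := abs_le.mp (h5.trans (by simpa [abs_mul, mul_pow] using h6))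
    linarith [h7.1]

lemma op_tail {Ω : Type*} [MeasurableSpace Ω] (P : Measure Ω) [IsProbabilityMeasure P]
    {m n : ℕ} (hmn : 0 < m + n) (G : Ω → Matrix (Fin m) (Fin n) ℝ) (v : NNReal) (hv : v ≠ 0)
    (hmeas : ∀ i j, Measurable fun ω => G ω i j)
    (hlaw : ∀ i j, P.map (fun ω => G ω i j) = gaussianReal 0 v)
    (hind : iIndepFun (fun (p : Fin m × Fin n) ω => G ω p.1 p.2) P) :
    P {ω | ¬ ∀ x, ‖Matrix.toEuclideanLin (G ω) x‖ ≤ √(96 * v * (m + n)) * ‖x‖}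
      ≤ ENNReal.ofReal (Real.exp (-((m : ℝ) + n))) := by
  have hv0 : (0 : ℝ) < v := by positivity
  have hmn' : (0 : ℝ) < (m : ℝ) + n := by exact_mod_cast hmn
  obtain ⟨s, hs2, hsc, hs⟩ := exists_net m
  obtain ⟨s', hs2', hsc', hs'⟩ := exists_net n
  set τ := √(96 * v * (m + n)) with hτ
  have hτ2 : τ ^ 2 = 96 * v * (m + n) := Real.sq_sqrt (by positivity)
  have hτ0 : 0 ≤ τ := Real.sqrt_nonneg _
  have hsub : {ω | ¬ ∀ x, ‖Matrix.toEuclideanLin (G ω) x‖ ≤ τ * ‖x‖} ⊆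
      ⋃ q ∈ s ×ˢ s', {ω | τ ≤ ∑ p : Fin m × Fin n, q.1 p.1 * q.2 p.2 * G ω p.1 p.2} := by
    intro ω hω
    by_contra hcon
    apply hω
    refine net_op (G ω) s s' hs hs' τ hτ0 fun c hc d hd => ?_
    by_contra! hlt
    apply hcon
    simp only [Set.mem_iUnion, Set.mem_ofPred_eq]
    refine ⟨(c, d), Finset.mem_product.mpr ⟨hc, hd⟩, hlt.le.trans (le_of_eq ?_)⟩
    rw [PiLp.inner_apply, Fintype.sum_prod_type]
    refine Finset.sum_congr rfl fun i _ => ?_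
    have : (Matrix.toEuclideanLin (G ω) d) i = ∑ j, G ω i j * d j := rfl
    rw [RCLike.inner_apply, this, conj_trivial, Finset.sum_mul]
    refine Finset.sum_congr rfl fun j _ => ?_
    ring
  have hone : ∀ q ∈ s ×ˢ s',
      P {ω | τ ≤ ∑ p : Fin m × Fin n, q.1 p.1 * q.2 p.2 * G ω p.1 p.2} ≤
        ENNReal.ofReal (Real.exp (-(3 * ((m : ℝ) + n)))) := by
    rintro ⟨c, d⟩ hq
    obtain ⟨hc, hd⟩ := Finset.mem_product.mp hq
    have hc2 := hs2 c hc
    have hd2 := hs2' d hd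
    have hlaw' : ∀ p : Fin m × Fin n,
        P.map (fun ω => G ω p.1 p.2) = gaussianReal 0 v := fun p => hlaw p.1 p.2
    have hmgf : ∀ (p : Fin m × Fin n) (l : ℝ),
        mgf (fun ω => c p.1 * d p.2 * G ω p.1 p.2) P l
          = Real.exp (v * (l * (c p.1 * d p.2)) ^ 2 / 2) := by
      intro p l
      have h := mgf_gaussianReal (hlaw' p) (l * (c p.1 * d p.2))
      rw [zero_mul, zero_add] at h
      rw [← h, mgf, mgf]
      congr 1
      funext ω
      ring_nf
    have h := chernoff P (fun (p : Fin m × Fin n) ω => c p.1 * d p.2 * G ω p.1 p.2)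
      (fun p => (hmeas p.1 p.2).const_mul _)
      (hind.comp (fun p x => c p.1 * d p.2 * x) (fun p => by fun_prop))
      (τ / (16 * v)) (by positivity)
      (fun p => v * (τ / (16 * v) * (c p.1 * d p.2)) ^ 2 / 2)
      (fun p => by
        have hpos : 0 < mgf (fun ω => c p.1 * d p.2 * G ω p.1 p.2) P (τ / (16 * v)) := by
          rw [hmgf]; exact Real.exp_pos _
        exact (mgf_pos_iff.mp hpos))
      (fun p => (hmgf p _).le) τ
    refine h.trans (ENNReal.ofReal_le_ofReal (Real.exp_le_exp.mpr ?_))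
    have hsum : ∑ p : Fin m × Fin n, (v : ℝ) * (τ / (16 * v) * (c p.1 * d p.2)) ^ 2 / 2
        = v * (τ / (16 * v)) ^ 2 / 2 * (‖c‖ ^ 2 * ‖d‖ ^ 2) := by
      rw [EuclideanSpace.norm_sq_eq, EuclideanSpace.norm_sq_eq, Finset.sum_mul_sum,
        Fintype.sum_prod_type, Finset.mul_sum]
      refine Finset.sum_congr rfl fun i _ => ?_
      rw [Finset.mul_sum]
      refine Finset.sum_congr rfl fun j _ => ?_
      simp only [Real.norm_eq_abs, sq_abs]
      ring
    rw [hsum]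
    have h16 : ‖c‖ ^ 2 * ‖d‖ ^ 2 ≤ 16 := by
      have h1 : ‖c‖ ^ 2 ≤ 4 := by nlinarith [norm_nonneg c]
      have h2 : ‖d‖ ^ 2 ≤ 4 := by nlinarith [norm_nonneg d]
      nlinarith [sq_nonneg ‖c‖, sq_nonneg ‖d‖]
    have h17 : v * (τ / (16 * v)) ^ 2 / 2 * (‖c‖ ^ 2 * ‖d‖ ^ 2)
        ≤ v * (τ / (16 * v)) ^ 2 / 2 * 16 := by gcongr
    have h18 : v * (τ / (16 * v)) ^ 2 / 2 * 16 = 3 * ((m : ℝ) + n) := by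
      rw [div_pow, hτ2]; field_simp; ring
    have h19 : τ / (16 * v) * τ = 6 * ((m : ℝ) + n) := by
      rw [div_mul_eq_mul_div, ← sq, hτ2]; field_simp; ring
    linarith
  refine (measure_mono hsub).trans ((measure_biUnion_finset_le _ _).trans
    ((Finset.sum_le_sum hone).trans ?_))
  rw [Finset.sum_const, nsmul_eq_mul, Finset.card_product]
  rw [← ENNReal.ofReal_natCast, ← ENNReal.ofReal_mul (by positivity)]
  apply ENNReal.ofReal_le_ofReal
  have h5 : (5 : ℝ) ≤ Real.exp 2 := by
    have := Real.quadratic_le_exp_of_nonneg (x := 2) (by norm_num)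
    norm_num at this; linarith
  have hcard : ((s.card * s'.card : ℕ) : ℝ) ≤ Real.exp (2 * ((m : ℝ) + n)) := by
    have h1 : ((s.card * s'.card : ℕ) : ℝ) ≤ (5 : ℝ) ^ (m + n) := by
      rw [pow_add]
      exact_mod_cast Nat.mul_le_mul hsc hsc'
    refine h1.trans ((pow_le_pow_left₀ (by norm_num) h5 _).trans (le_of_eq ?_))
    rw [← Real.exp_nat_mul]
    push_cast
    congr 1
    ring
  refine (mul_le_mul_of_nonneg_right hcard (Real.exp_pos _).le).trans (le_of_eq ?_)
  rw [← Real.exp_add]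
  congr 1
  ring

lemma frob_tail {Ω : Type*} [MeasurableSpace Ω] (P : Measure Ω) [IsProbabilityMeasure P]
    {m n : ℕ} (hm : 0 < m) (hn : 0 < n) (G : Ω → Matrix (Fin m) (Fin n) ℝ) (v : NNReal)
    (hv : v ≠ 0)
    (hmeas : ∀ i j, Measurable fun ω => G ω i j)
    (hlaw : ∀ i j, P.map (fun ω => G ω i j) = gaussianReal 0 v)
    (hind : iIndepFun (fun (p : Fin m × Fin n) ω => G ω p.1 p.2) P) (ε : ℝ) (hε : ε = 1 ∨ ε = -1) :
    P {ω | √((m * n) * (m + n)) ≤ ε * (frob (G ω) ^ 2 / v - m * n)}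
      ≤ ENNReal.ofReal (Real.exp (-(((m : ℝ) + n) / 16))) := by
  have hm1 : (1 : ℝ) ≤ m := by exact_mod_cast hm
  have hn1 : (1 : ℝ) ≤ n := by exact_mod_cast hn
  have hv0 : (0 : ℝ) < v := by positivity
  have hε2 : ε ^ 2 = 1 := by rcases hε with rfl | rfl <;> norm_num
  have hεa : |ε| = 1 := by rcases hε with rfl | rfl <;> norm_num
  set l : ℝ := √(((m : ℝ) + n) / (m * n)) / 8 with hl
  have hl0 : 0 ≤ l := by positivity
  have hl2 : l ^ 2 = ((m : ℝ) + n) / (m * n) / 64 := by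
    rw [hl, div_pow, Real.sq_sqrt (by positivity)]; norm_num
  have hl4 : l ≤ 1 / 4 := by
    have : ((m : ℝ) + n) / (m * n) ≤ 2 := by
      rw [div_le_iff₀ (by positivity)]; nlinarith
    nlinarith
  have hlε : |l * ε| ≤ 1 / 4 := by rw [abs_mul, hεa, mul_one, abs_of_nonneg hl0]; exact hl4
  obtain ⟨hI1, hI2⟩ := gauss_sq_integrable v hv (l * ε) hlε
  have hae : ∀ p : Fin m × Fin n, AEMeasurable (fun ω => G ω p.1 p.2) P :=
    fun p => (hmeas p.1 p.2).aemeasurable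
  have hcm : Measurable (fun x : ℝ => Real.exp (l * ε * (x ^ 2 / v - 1))) := by fun_prop
  have h := chernoff P (fun (p : Fin m × Fin n) ω => ε * ((G ω p.1 p.2) ^ 2 / v - 1))
      (fun p => by have := hmeas p.1 p.2; fun_prop)
      (hind.comp (fun p x => ε * (x ^ 2 / v - 1)) (fun p => by fun_prop))
      l hl0 (fun _ => 4 * l ^ 2)
      (fun p => by
        rw [← hlaw p.1 p.2, integrable_map_measure hcm.aestronglyMeasurable (hae p)] at hI1
        refine hI1.congr (Filter.Eventually.of_forall fun ω => ?_)
        simp only [Function.comp]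
        congr 1; ring)
      (fun p => by
        rw [← hlaw p.1 p.2, integral_map (hae p) hcm.aestronglyMeasurable, mul_pow, hε2,
          mul_one] at hI2
        refine le_trans (le_of_eq ?_) hI2
        rw [mgf]
        congr 1
        funext ω
        ring_nf) √((m * n) * (m + n))
  have hset : ∀ ω, ∑ p : Fin m × Fin n, ε * ((G ω p.1 p.2) ^ 2 / v - 1)
      = ε * (frob (G ω) ^ 2 / v - m * n) := by
    intro ω
    rw [frob_sq, ← Finset.mul_sum, Finset.sum_sub_distrib, ← Finset.sum_div,
      Fintype.sum_prod_type]
    simp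
  simp only [hset] at h
  refine h.trans (ENNReal.ofReal_le_ofReal (Real.exp_le_exp.mpr ?_))
  have h1 : ∑ _p : Fin m × Fin n, 4 * l ^ 2 = ((m : ℝ) + n) / 16 := by
    rw [Finset.sum_const, hl2, nsmul_eq_mul]
    simp only [Finset.card_univ, Fintype.card_prod, Fintype.card_fin]
    push_cast
    field_simp
    norm_num
  have h2 : l * √((m * n) * (m + n)) = ((m : ℝ) + n) / 8 := by
    rw [hl, div_mul_eq_mul_div, ← Real.sqrt_mul (by positivity)]
    congr 1
    rw [← Real.sqrt_sq (by positivity : (0 : ℝ) ≤ (m : ℝ) + n)]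
    congr 1
    field_simp
    rw [Real.sqrt_sq (by positivity)]
  rw [h1, h2]
  linarith

lemma final_arith (N1 T r σ2 F H : ℝ) (hN1R : 1 ≤ N1) (hTR : 1 ≤ T) (hrR : 1 ≤ r)
    (hσ2 : 0 < σ2) (hrN : r ≤ N1) (hrT : r ≤ T)
    (hdet : |F - H| ≤ 2 * r * (96 * σ2 * (N1 + T)))
    (hcon2 : 1 * (H / σ2 - N1 * T) < √((N1 * T) * (N1 + T)))
    (hcon3 : -1 * (H / σ2 - N1 * T) < √((N1 * T) * (N1 + T))) :
    |F / (N1 * T) - σ2| ≤ 300 * σ2 * √((N1 + T) * r / (N1 * T)) := by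
  set a : ℝ := (N1 + T) / (N1 * T) with ha
  set b : ℝ := (N1 + T) * r / (N1 * T) with hb
  have hb0 : 0 < b := by positivity
  have hba : b = r * a := by rw [hb, ha]; ring
  have ha0 : 0 < a := by positivity
  have hab : a ≤ b := by rw [hba]; nlinarith
  have hb2 : b ≤ 2 := by
    rw [hb, div_le_iff₀ (by positivity)]
    nlinarith
  have hsa : √a ≤ √b := Real.sqrt_le_sqrt hab
  have hbs : b ≤ 3 / 2 * √b := by
    have h1 : √b ≤ 3 / 2 := by
      rw [Real.sqrt_le_left (by norm_num)]; linarith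
    have h2 := Real.mul_self_sqrt hb0.le
    nlinarith [Real.sqrt_nonneg b]
  have hsq : √((N1 * T : ℝ) * (N1 + T)) = N1 * T * √a := by
    rw [← Real.sqrt_sq (by positivity : (0 : ℝ) ≤ N1 * T), ← Real.sqrt_mul (by positivity),
      Real.sqrt_sq (by positivity)]
    congr 1
    rw [ha]; field_simp
  rw [hsq] at hcon2 hcon3
  have hn0 : (0 : ℝ) < N1 * T := by positivity
  have e1 : |H / (N1 * T) - σ2| ≤ σ2 * √a := by
    have : H / (N1 * T) - σ2 = σ2 / (N1 * T) * (H / σ2 - N1 * T) := by field_simp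
    rw [this, abs_mul, abs_of_pos (by positivity)]
    have h3 : |H / σ2 - N1 * T| ≤ N1 * T * √a := abs_le.mpr ⟨by linarith, by linarith⟩
    calc _ ≤ σ2 / (N1 * T) * (N1 * T * √a) := by gcongr
      _ = _ := by field_simp
  have e2 : |F / (N1 * T) - H / (N1 * T)| ≤ 192 * σ2 * b := by
    rw [← sub_div, abs_div, abs_of_pos hn0, div_le_iff₀ hn0]
    refine hdet.trans (le_of_eq ?_)
    rw [hb]; field_simp; norm_num
  have e3 := abs_sub_le (F / (N1 * T : ℝ)) (H / (N1 * T)) σ2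
  have e4 : 192 * σ2 * b ≤ 192 * σ2 * (3 / 2 * √b) := by gcongr
  have e5 : σ2 * √a ≤ σ2 * √b := by gcongr
  nlinarith [mul_nonneg hσ2.le (Real.sqrt_nonneg b)]


/-- concentration of the noise-variance estimate (Lemma `LemSigBound`). -/
theorem stmt12 :
    ∃ Cσ c_noise c0 : ℝ, 0 < Cσ ∧ 0 < c_noise ∧ 0 < c0 ∧
    ∀ (N T N1 T1 r : ℕ) (hN1 : 0 < N1) (hNlt : N1 < N) (hT1 : 0 < T1) (hTlt : T1 < T)
      (hr : 0 < r) (w cl cu σr : ℝ) (hw : 0 < w) (hcl : 0 < cl) (hcu : cl ≤ cu)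
      (Ustar : Matrix (Fin N) (Fin r) ℝ) (sstar : Fin r → ℝ) (Vstar : Matrix (Fin T) (Fin r) ℝ)
      (Mstar : Matrix (Fin N) (Fin T) ℝ)
      (hUorth : Ustarᵀ * Ustar = 1) (hVorth : Vstarᵀ * Vstar = 1)
      (hsdec : ∀ k l : Fin r, k ≤ l → sstar l ≤ sstar k) (hspos : ∀ k, 0 < sstar k)
      (hM : Mstar = Ustar * Matrix.diagonal sstar * Vstarᵀ)
      (hσr : σr = sstar ⟨r - 1, by omega⟩)
      -- sub-block condition
      (hsub1 : ((topRows hNlt.le Ustar)ᵀ * topRows hNlt.le Ustar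
          - (cl * N1 / N) • (1 : Matrix (Fin r) (Fin r) ℝ)).PosSemidef)
      (hsub2 : ((cu * N1 / N) • (1 : Matrix (Fin r) (Fin r) ℝ)
          - (topRows hNlt.le Ustar)ᵀ * topRows hNlt.le Ustar).PosSemidef)
      (hsub3 : ((topRows hTlt.le Vstar)ᵀ * topRows hTlt.le Vstar
          - (cl * T1 / T) • (1 : Matrix (Fin r) (Fin r) ℝ)).PosSemidef)
      (hsub4 : ((cu * T1 / T) • (1 : Matrix (Fin r) (Fin r) ℝ)
          - (topRows hTlt.le Vstar)ᵀ * topRows hTlt.le Vstar).PosSemidef)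
      (hmin : c0 * Real.log ((N : ℝ) + T) ≤ min (N1 : ℝ) T1)
      -- probability space and Gaussian noise on the observed entries
      (Ω : Type) [MeasurableSpace Ω] (P : Measure Ω) [IsProbabilityMeasure P]
      (E : Ω → Matrix (Fin N) (Fin T) ℝ) (hEmeas : ∀ (a : Fin N) (b : Fin T), Measurable (fun ω => E ω a b))
      (hEgauss : ∀ (a : Fin N) (b : Fin T), (a.1 < N1 ∨ b.1 < T1) →
        P.map (fun ω => E ω a b) = gaussianReal 0 (Real.toNNReal (w ^ 2 / (N * T))))
      (hEindep : iIndepFun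
        (fun (p : {p : Fin N × Fin T // p.1.1 < N1 ∨ p.2.1 < T1}) (ω : Ω) => E ω p.1.1 p.1.2) P)
      -- extra sample-size condition N1·T ≥ L
      (hNT : Real.log ((N : ℝ) + T) ≤ (N1 : ℝ) * T)
      -- error level and noise condition
      (δ : ℝ) (hδ0 : 0 < δ) (hδ1 : δ ≤ 1)
      (hnoise : (w / σr) * Real.sqrt ((r + Real.log ((N : ℝ) + T)) / min (N1 : ℝ) T1)
        ≤ c_noise * δ)
      -- rank-r truncated SVD of M_upper
      (Uu : Ω → Matrix (Fin N1) (Fin r) ℝ) (su : Ω → Fin r → ℝ)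
      (Vu : Ω → Matrix (Fin T) (Fin r) ℝ)
      (hSVDu : ∀ ω, IsTruncSVD r ((Mstar + E ω).submatrix (Fin.castLE hNlt.le) id)
          (Uu ω) (su ω) (Vu ω)),
      -- conclusion
      let σ2 : ℝ := w ^ 2 / (N * T)
      let σ2hat : Ω → ℝ := fun ω =>
        ((N / N1 : ℝ) * frob ((Mstar + E ω).submatrix (Fin.castLE hNlt.le) id
            - Uu ω * Matrix.diagonal (su ω) * (Vu ω)ᵀ) ^ 2) / (N * T)
      ENNReal.ofReal (1 - Cσ * ((N : ℝ) + T) ^ (-(10 : ℤ))) ≤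
        P {ω | |σ2hat ω - σ2| ≤
          Cσ * σ2 * Real.sqrt (((N1 : ℝ) + T) * r / ((N1 : ℝ) * T))} := by
  refine ⟨300, 1, 160, by norm_num, by norm_num, by norm_num, ?_⟩
  intro N T N1 T1 r hN1 hNlt hT1 hTlt hr w cl cu σr hw hcl hcu Ustar sstar Vstar Mstar hUorth
    hVorth hsdec hspos hM hσr hsub1 hsub2 hsub3 hsub4 hmin Ω _ P _ E hEmeas hEgauss hEindep hNT
    δ hδ0 hδ1 hnoise Uu su Vu hSVDu σ2 σ2hat
  have hT : 0 < T := by omega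
  have hN : 0 < N := by omega
  have hNR : (1 : ℝ) ≤ N := by exact_mod_cast hN
  have hTR : (1 : ℝ) ≤ T := by exact_mod_cast hT
  have hN1R : (1 : ℝ) ≤ N1 := by exact_mod_cast hN1
  have hrR : (1 : ℝ) ≤ r := by exact_mod_cast hr
  have hσ2 : 0 < σ2 := by positivity
  set v : NNReal := Real.toNNReal (w ^ 2 / (N * T)) with hvdef
  have hvσ : (v : ℝ) = σ2 := Real.coe_toNNReal _ hσ2.le
  have hv : v ≠ 0 := by
    intro h
    rw [h] at hvσ
    simp at hvσ
    exact hσ2.ne hvσ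
  set G : Ω → Matrix (Fin N1) (Fin T) ℝ := fun ω => (E ω).submatrix (Fin.castLE hNlt.le) id with hG
  have hGmeas : ∀ i j, Measurable fun ω => G ω i j := fun i j => hEmeas _ _
  have hGlaw : ∀ i j, P.map (fun ω => G ω i j) = gaussianReal 0 v :=
    fun i j => hEgauss _ _ (Or.inl i.2)
  have hGind : iIndepFun (fun (p : Fin N1 × Fin T) ω => G ω p.1 p.2) P := by
    refine hEindep.precomp (g := fun p : Fin N1 × Fin T =>
      (⟨(Fin.castLE hNlt.le p.1, p.2), Or.inl p.1.2⟩ :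
        {p : Fin N × Fin T // p.1.1 < N1 ∨ p.2.1 < T1})) ?_
    rintro ⟨a, b⟩ ⟨a', b'⟩ h
    simp only [Subtype.mk.injEq, Prod.mk.injEq] at h
    exact Prod.ext (Fin.castLE_injective _ h.1) h.2
  -- the three bad events
  have hB1 := op_tail P (by omega) G v hv hGmeas hGlaw hGind
  have hB2 := frob_tail P hN1 hT G v hv hGmeas hGlaw hGind 1 (Or.inl rfl)
  have hB3 := frob_tail P hN1 hT G v hv hGmeas hGlaw hGind (-1) (Or.inr rfl)
  have hNT0 : (0 : ℝ) < (N : ℝ) + T := by linarith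
  have hlog : Real.log ((N : ℝ) + T) * 160 ≤ N1 := by
    have := hmin.trans (min_le_left _ _)
    linarith
  have hlog0 : 0 ≤ Real.log ((N : ℝ) + T) := Real.log_nonneg (by linarith)
  have hpw : Real.exp (-(((N1 : ℝ) + T) / 16)) ≤ ((N : ℝ) + T) ^ (-(10 : ℤ)) := by
    have : ((N : ℝ) + T) ^ (-(10 : ℤ)) = Real.exp (-(10 * Real.log ((N : ℝ) + T))) := by
      rw [_root_.zpow_neg, Real.exp_neg]
      congr 1
      rw [mul_comm, Real.exp_mul, Real.exp_log hNT0]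
      norm_cast
    rw [this]
    apply Real.exp_le_exp.mpr
    linarith
  have hpw1 : Real.exp (-((N1 : ℝ) + T)) ≤ ((N : ℝ) + T) ^ (-(10 : ℤ)) := by
    refine le_trans (Real.exp_le_exp.mpr ?_) hpw
    linarith
  set π := ((N : ℝ) + T) ^ (-(10 : ℤ)) with hπ
  have hπ0 : 0 ≤ π := by positivity
  set S : Set Ω := {ω | |σ2hat ω - σ2| ≤
    300 * σ2 * Real.sqrt (((N1 : ℝ) + T) * r / ((N1 : ℝ) * T))} with hS
  have hsub : Sᶜ ⊆ ({ω | ¬ ∀ x, ‖Matrix.toEuclideanLin (G ω) x‖ ≤ √(96 * v * (N1 + T)) * ‖x‖} ∪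
      {ω | √((N1 * T) * (N1 + T)) ≤ 1 * (frob (G ω) ^ 2 / v - N1 * T)}) ∪
      {ω | √((N1 * T) * (N1 + T)) ≤ -1 * (frob (G ω) ^ 2 / v - N1 * T)} := by
    intro ω hω
    by_contra hcon
    apply hω
    have hcon1 : ∀ x, ‖Matrix.toEuclideanLin (G ω) x‖ ≤ √(96 * v * (N1 + T)) * ‖x‖ := by
      by_contra h
      exact hcon (Or.inl (Or.inl h))
    have hcon2 : 1 * (frob (G ω) ^ 2 / v - N1 * T) < √((N1 * T) * (N1 + T)) := by
      by_contra! h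
      exact hcon (Or.inl (Or.inr h))
    have hcon3 : -1 * (frob (G ω) ^ 2 / v - N1 * T) < √((N1 * T) * (N1 + T)) := by
      by_contra! h
      exact hcon (Or.inr h)
    have hY : (Mstar + E ω).submatrix (Fin.castLE hNlt.le) id
        = Mstar.submatrix (Fin.castLE hNlt.le) id + G ω := rfl
    have hA : Mstar.submatrix (Fin.castLE hNlt.le) id
        = (topRows hNlt.le Ustar * Matrix.diagonal sstar) * Vstarᵀ := by
      rw [hM]; rfl
    have hdet := frob_resid (hSVDu ω) hY _ _ hA _ (Real.sqrt_nonneg _) hcon1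
    rw [Real.sq_sqrt (by positivity), hvσ] at hdet
    rw [hvσ] at hcon2 hcon3
    have hrN : (r : ℝ) ≤ N1 := by exact_mod_cast orth_le _ (hSVDu ω).orthU
    have hrT : (r : ℝ) ≤ T := by exact_mod_cast orth_le _ (hSVDu ω).orthV
    show |σ2hat ω - σ2| ≤ _
    set F := frob ((Mstar + E ω).submatrix (Fin.castLE hNlt.le) id
            - Uu ω * Matrix.diagonal (su ω) * (Vu ω)ᵀ) ^ 2 with hF
    set H := frob (G ω) ^ 2 with hH
    have hσh : σ2hat ω = F / (N1 * T) := by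
      show ((N / N1 : ℝ) * F) / (N * T) = _
      field_simp
    rw [hσh]
    exact final_arith N1 T r σ2 F H hN1R hTR hrR hσ2 hrN hrT hdet hcon2 hcon3
  have hbad : P Sᶜ ≤ ENNReal.ofReal (300 * π) := by
    refine (measure_mono hsub).trans ((measure_union_le _ _).trans
      ((add_le_add (measure_union_le _ _) le_rfl).trans
      ((add_le_add (add_le_add hB1 hB2) hB3).trans ?_)))
    rw [← ENNReal.ofReal_add (Real.exp_pos _).le (Real.exp_pos _).le,
      ← ENNReal.ofReal_add (by positivity) (Real.exp_pos _).le]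
    apply ENNReal.ofReal_le_ofReal
    linarith
  have hone : (1 : ENNReal) ≤ P S + P Sᶜ := by
    rw [← measure_univ (μ := P), ← Set.union_compl_self S]
    exact measure_union_le _ _
  rw [ENNReal.ofReal_sub _ (by positivity), ENNReal.ofReal_one]
  refine tsub_le_iff_right.mpr (hone.trans ?_)
  gcongr

end
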